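/- arXiv:2002.06812 — 5 statements merged into one kernel-verified Lean document; each statement's English description precedes it below -/
import Mathlib

section
/- Let V be a finite set, S ⊆ V, t ≥ 1 and s ≥ 2 integers, and let T_1, …, T_m be finitely many trees, each a connected acyclic simple graph whose vertex set is a subset of V. Assume (i) every leaf (degree-1 vertex) of every T_j belongs to S, and (ii) every vertex of S belongs to at most t of the trees T_1, …, T_m (i.e., for each v ∈ S, |{j : v ∈ V(T_j)}| ≤ t). Then the set of vertices v ∈ V that have degree strictly greater than s in at least one tree T_j has cardinality at most t·|S|/(s − 1). -/
/-- In a finite tree, `s - 1` times the number of vertices of degree greater than `s` is at most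
the number of leaves. -/
theorem SimpleGraph.IsTree.mul_card_lt_degree_le_card_leaves {W : Type*} [Fintype W]
    {G : SimpleGraph W} [DecidableRel G.Adj] (hG : G.IsTree) (s : ℕ) (hs : 1 ≤ s) :
    (s - 1) * (Finset.univ.filter (fun x => s < G.degree x)).card ≤
      (Finset.univ.filter (fun x => G.degree x = 1)).card := by
  rcases subsingleton_or_nontrivial W with hW | hW
  · simp
  · have hpos : ∀ x, 0 < G.degree x := fun x =>
      hG.connected.preconnected.degree_pos_of_nontrivial x
    have hsum := G.sum_degrees_eq_twice_card_edges
    have hedges := hG.card_edgeFinset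
    have hpoint : ∀ x ∈ (Finset.univ : Finset W),
        ((s - 1) * if s < G.degree x then 1 else 0) + 2 ≤
          G.degree x + if G.degree x = 1 then 1 else 0 := by
      intro x _
      have := hpos x
      split_ifs <;> omega
    have hle := Finset.sum_le_sum hpoint
    rw [Finset.sum_add_distrib, Finset.sum_add_distrib, ← Finset.mul_sum, ← Finset.card_filter,
      ← Finset.card_filter, Finset.sum_const, Finset.card_univ, smul_eq_mul] at hle
    omega

/-- Let `V` be a finite set, `S ⊆ V`, `t ≥ 1` and `s ≥ 2` integers, and let
`T 0, …, T (m-1)` be finitely many trees, each a connected acyclic simple graph whose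
vertex set `A j` is a subset of `V`. If every leaf of every tree belongs to `S`, and
every vertex of `S` belongs to at most `t` of the trees, then the set of vertices of
`V` having degree `> s` in at least one of the trees has cardinality at most
`t * |S| / (s - 1)`. -/
theorem stmt1 {V : Type*} [Fintype V] [DecidableEq V] (S : Finset V)
    (t s : ℕ) (ht : 1 ≤ t) (hs : 2 ≤ s) (m : ℕ)
    (A : Fin m → Finset V) (T : (j : Fin m) → SimpleGraph (A j))
    [∀ j, DecidableRel (T j).Adj]
    (htree : ∀ j, (T j).IsTree)
    (hleaf : ∀ (j : Fin m) (x : (A j : Finset V)), (T j).degree x = 1 → (x : V) ∈ S)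
    (hcount : ∀ v ∈ S, (Finset.univ.filter (fun j : Fin m => v ∈ A j)).card ≤ t) :
    ({v : V | ∃ (j : Fin m) (h : v ∈ A j), s < (T j).degree ⟨v, h⟩}.ncard : ℝ) ≤
      (t : ℝ) * (S.card : ℝ) / ((s : ℝ) - 1) := by
  classical
  let H : (j : Fin m) → Finset (A j) := fun j =>
    Finset.univ.filter (fun x => s < (T j).degree x)
  have hsub : {v : V | ∃ (j : Fin m) (h : v ∈ A j), s < (T j).degree ⟨v, h⟩} ⊆
      ((Finset.univ.biUnion fun j => (H j).image Subtype.val : Finset V) : Set V) := by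
    rintro v ⟨j, h, hv⟩
    simp only [Finset.coe_biUnion, Set.mem_iUnion]
    exact ⟨j, by simp, Finset.mem_coe.2 (Finset.mem_image.2 ⟨⟨v, h⟩, by simpa [H] using hv, rfl⟩)⟩
  have hcard : {v : V | ∃ (j : Fin m) (h : v ∈ A j), s < (T j).degree ⟨v, h⟩}.ncard ≤
      ∑ j, (H j).card := by
    refine (Set.ncard_le_ncard hsub (Finset.finite_toSet _)).trans ?_
    rw [Set.ncard_coe_finset]
    exact Finset.card_biUnion_le.trans (Finset.sum_le_sum fun j _ => Finset.card_image_le)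
  have htree_le : ∀ j, (s - 1) * (H j).card ≤ (S.filter (fun v => v ∈ A j)).card := by
    intro j
    refine ((htree j).mul_card_lt_degree_le_card_leaves s (by omega)).trans ?_
    refine Finset.card_le_card_of_injOn Subtype.val ?_ Subtype.val_injective.injOn
    intro x hx
    exact Finset.mem_coe.2 (Finset.mem_filter.2 ⟨hleaf j x (by simpa using hx), x.2⟩)
  have hdouble : ∑ j, (S.filter (fun v => v ∈ A j)).card ≤ S.card * t := by
    calc ∑ j, (S.filter (fun v => v ∈ A j)).card
        = ∑ v ∈ S, (Finset.univ.filter (fun j : Fin m => v ∈ A j)).card := by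
          simp only [Finset.card_filter]
          exact Finset.sum_comm
      _ ≤ S.card * t := Finset.sum_le_card_nsmul S _ t hcount
  have hmain : (s - 1) * {v : V | ∃ (j : Fin m) (h : v ∈ A j),
      s < (T j).degree ⟨v, h⟩}.ncard ≤ S.card * t :=
    calc _ ≤ (s - 1) * ∑ j, (H j).card := Nat.mul_le_mul_left _ hcard
      _ = ∑ j, (s - 1) * (H j).card := Finset.mul_sum _ _ _
      _ ≤ ∑ j, (S.filter (fun v => v ∈ A j)).card := Finset.sum_le_sum fun j _ => htree_le j
      _ ≤ S.card * t := hdouble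
  have hs' : (2 : ℝ) ≤ s := by exact_mod_cast hs
  rw [le_div_iff₀ (by linarith)]
  have hreal := (Nat.cast_le (α := ℝ)).2 hmain
  rw [Nat.cast_mul, Nat.cast_mul, Nat.cast_sub (by omega), Nat.cast_one] at hreal
  linarith
end

section
/- Let (V, d) be a finite metric space, let k ≥ 1 be an integer, and let A_0 ⊇ A_1 ⊇ ⋯ ⊇ A_{k−1} ⊇ A_k = ∅ be a nested chain of subsets of V. For w ∈ A_0, let i(w) be the unique index with w ∈ A_{i(w)} ∖ A_{i(w)+1}, and define the cluster C(w) = {x ∈ V : d(x, w) < d(x, A_{i(w)+1})}, where d(x, A) = min_{a ∈ A} d(x, a) and d(x, ∅) = +∞. Then for every u ∈ A_0 and every v ∈ V there exists w ∈ A_0 such that u ∈ C(w), v ∈ C(w), and d(u, w) + d(v, w) ≤ (2k − 1)·d(u, v). -/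
/-- The alternating search for a common cluster, started at level `i` from a point `w ∈ A i`
with `dist x w ≤ i * dist x y`. -/
theorem exists_common_cluster_of_dist_le {V : Type*} [PseudoMetricSpace V] {k : ℕ}
    {A : ℕ → Set V} (hchain : ∀ i < k, A (i + 1) ⊆ A i) (hAk : A k = ∅) {i : ℕ} (hik : i ≤ k)
    (x y : V) {w : V} (hw : w ∈ A i) (hxw : dist x w ≤ i * dist x y) :
    ∃ w ∈ A 0, ∃ i < k, w ∈ A i ∧ w ∉ A (i + 1) ∧
      (∀ a ∈ A (i + 1), dist x w < dist x a) ∧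
      (∀ a ∈ A (i + 1), dist y w < dist y a) ∧
      dist x w + dist y w ≤ (2 * (k : ℝ) - 1) * dist x y := by
  have anti : ∀ j ≤ k, A j ⊆ A 0 := fun j ↦ by
    induction j with
    | zero => exact fun _ ↦ subset_rfl
    | succ j ih => exact fun hj ↦ (hchain j hj).trans (ih (by omega))
  induction hik using Nat.decreasingInduction generalizing x y w with
  | self => simp [hAk] at hw
  | of_succ i hi ih =>
    have hd : 0 ≤ dist x y := dist_nonneg
    have hyw : dist y w ≤ (i + 1) * dist x y := by
      linarith [dist_triangle_left y w x]
    by_cases hx : ∀ a ∈ A (i + 1), dist x w < dist x a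
    · by_cases hy : ∀ a ∈ A (i + 1), dist y w < dist y a
      · refine ⟨w, anti i hi.le hw, i, hi, hw, fun h ↦ (hx w h).false, hx, hy, ?_⟩
        have hik : (i : ℝ) + 1 ≤ k := by exact_mod_cast hi
        nlinarith
      · push Not at hy
        obtain ⟨a, ha, hya⟩ := hy
        obtain ⟨z, hz₀, j, hj, hz, hz', hzy, hzx, hle⟩ :=
          ih y x ha (by rw [dist_comm y x]; push_cast; exact hya.trans hyw)
        exact ⟨z, hz₀, j, hj, hz, hz', hzx, hzy, by rwa [add_comm, dist_comm x y]⟩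
    · push Not at hx
      obtain ⟨a, ha, hxa⟩ := hx
      exact ih x y ha (by push_cast; linarith)

/-- Thorup–Zwick stretch property. Let `(V, dist)` be a finite metric space, `k ≥ 1`,
and `A 0 ⊇ A 1 ⊇ ⋯ ⊇ A k = ∅` a nested chain of subsets. For `w ∈ A i \ A (i+1)` the
cluster of `w` is `C w = {x | dist x w < dist x (A (i+1))}` (where the distance to the
empty set is `+∞`, i.e. the condition is vacuous). Then for every `u ∈ A 0` and every
`v ∈ V` there exists `w ∈ A 0` with `u ∈ C w`, `v ∈ C w` and
`dist u w + dist v w ≤ (2k - 1) * dist u v`. -/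
theorem stmt3 {V : Type*} [MetricSpace V] [Fintype V] (k : ℕ) (hk : 1 ≤ k)
    (A : ℕ → Set V) (hchain : ∀ i < k, A (i + 1) ⊆ A i) (hAk : A k = ∅) :
    ∀ u ∈ A 0, ∀ v : V, ∃ w ∈ A 0, ∃ i < k, w ∈ A i ∧ w ∉ A (i + 1) ∧
      (∀ a ∈ A (i + 1), dist u w < dist u a) ∧
      (∀ a ∈ A (i + 1), dist v w < dist v a) ∧
      dist u w + dist v w ≤ (2 * (k : ℝ) - 1) * dist u v := by
  intro u hu v
  exact exists_common_cluster_of_dist_le hchain hAk k.zero_le u v hu (by simp)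
end

section
/- Let (M, dist) be a metric space, V a finite subset of M, ε > 0, and ε₁ = ε/(2+ε). Let R : V × V → [0, +∞] be a symmetric function (R(a,b) = R(b,a)) with dist(a,b) ≤ R(a,b) for all a, b ∈ V. For u, v ∈ V define δ_H(u,v) as the infimum over all finite sequences u = w_0, w_1, …, w_m = v of elements of V of ∑_{i<m} R(w_i, w_{i+1}). Assume that for all a, b ∈ V with dist(a,b) < R(a,b) there exist x ∈ M, w ∈ V, and y ∈ {a, b} with dist(x,y) = min(dist(x,a), dist(x,b)), such that: dist(a,x) + dist(x,b) = dist(a,b); 0 < dist(a,x) and 0 < dist(x,b); dist(x,w) ≤ ε₁·dist(x,y); and R(y,w) ≤ dist(y,x) + dist(x,w). Then for all u, v ∈ V, δ_H(u,v) ≤ (1+ε)·dist(u,v). -/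
open scoped ENNReal

/-- The shortest-path distance `δ_H u v` in the complete graph on the finite vertex
set `V` with edge weights `R`: the infimum over all finite sequences
`u = w 0, w 1, …, w m = v` of elements of `V` of `∑ i < m, R (w i) (w (i+1))`. -/
noncomputable def deltaH {M : Type*} (V : Finset M) (R : M → M → ℝ≥0∞)
    (u v : M) : ℝ≥0∞ :=
  ⨅ (m : ℕ) (w : Fin (m + 1) → M) (_ : w 0 = u) (_ : w (Fin.last m) = v)
    (_ : ∀ i, w i ∈ V), ∑ i : Fin m, R (w i.castSucc) (w i.succ)

section

variable {M : Type*} {V : Finset M} {R : M → M → ℝ≥0∞}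

theorem deltaH_le_sum {m : ℕ} (w : Fin (m + 1) → M) (hw : ∀ i, w i ∈ V) :
    deltaH V R (w 0) (w (Fin.last m)) ≤ ∑ i : Fin m, R (w i.castSucc) (w i.succ) :=
  iInf_le_of_le m <| iInf_le_of_le w <| iInf_le_of_le rfl <| iInf_le_of_le rfl <|
    iInf_le_of_le hw le_rfl

theorem deltaH_le_edge {u v : M} (hu : u ∈ V) (hv : v ∈ V) : deltaH V R u v ≤ R u v := by
  have h := deltaH_le_sum (V := V) (R := R) ![u, v] (by simp [Fin.forall_fin_two, hu, hv])
  simpa using h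

theorem deltaH_le_edge_add {u w v : M} (hu : u ∈ V) :
    deltaH V R u v ≤ R u w + deltaH V R w v := by
  conv_rhs => rw [deltaH]
  simp only [ENNReal.add_iInf, le_iInf_iff]
  rintro m p rfl rfl hp
  have h := deltaH_le_sum (V := V) (R := R) (Fin.cons u p : Fin (m + 1 + 1) → M)
    (Fin.cases hu hp)
  rw [Fin.sum_univ_succ] at h
  simpa [← Fin.succ_last, ← Fin.succ_castSucc] using h

theorem deltaH_le_add_edge {u w v : M} (hv : v ∈ V) :
    deltaH V R u v ≤ deltaH V R u w + R w v := by
  conv_rhs => rw [deltaH]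
  simp only [ENNReal.iInf_add, le_iInf_iff]
  rintro m p rfl rfl hp
  have h := deltaH_le_sum (V := V) (R := R) (Fin.snoc p v : Fin (m + 1 + 1) → M)
    (Fin.lastCases (by simpa using hv) (by simpa using hp))
  rw [Fin.sum_univ_castSucc] at h
  have h0 : (Fin.snoc p v : Fin (m + 1 + 1) → M) 0 = p 0 := Fin.snoc_castSucc (i := 0) ..
  simpa only [h0, Fin.snoc_last, Fin.snoc_castSucc, Fin.succ_castSucc, Fin.succ_last] using h

end

/-- Going from `y` past a point `x` at distance `p` to a nearby `w`, and from there to an endpoint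
at distance `q` from `x`, makes progress and stays within the stretch `1 + ε`. -/
theorem detour_bounds {ε p q r d : ℝ} (hε : 0 < ε) (hp : 0 < p)
    (hr : r ≤ ε / (2 + ε) * p) (hd : d ≤ r + q) :
    d < p + q ∧ (p + r) + (1 + ε) * d ≤ (1 + ε) * (p + q) := by
  have h2 : 0 < 2 + ε := by linarith
  have hr' : (2 + ε) * r ≤ ε * p := by
    calc (2 + ε) * r ≤ (2 + ε) * (ε / (2 + ε) * p) := by gcongr
      _ = ε * p := by field_simp
  constructor
  · nlinarith
  · nlinarith

/-- Abstract form of Theorem 3.8. Let `(M, dist)` be a metric space, `V` a finite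
subset, `ε > 0` and `ε₁ = ε / (2 + ε)`. Let `R : M → M → [0, +∞]` be symmetric on `V`
with `dist a b ≤ R a b` for `a, b ∈ V`. Suppose that whenever `dist a b < R a b` for
`a, b ∈ V`, there exist `x ∈ M`, `w ∈ V` and `y ∈ {a, b}` with
`dist x y = min (dist x a) (dist x b)`, such that `x` lies strictly between `a` and
`b`, `dist x w ≤ ε₁ * dist x y`, and `R y w ≤ dist y x + dist x w`. Then
`δ_H u v ≤ (1 + ε) * dist u v` for all `u, v ∈ V`. -/
theorem stmt8 {M : Type*} [MetricSpace M] (V : Finset M) (ε : ℝ) (hε : 0 < ε)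
    (R : M → M → ℝ≥0∞)
    (hsym : ∀ a ∈ V, ∀ b ∈ V, R a b = R b a)
    (hlow : ∀ a ∈ V, ∀ b ∈ V, ENNReal.ofReal (dist a b) ≤ R a b)
    (hkey : ∀ a ∈ V, ∀ b ∈ V, ENNReal.ofReal (dist a b) < R a b →
      ∃ (x w y : M), w ∈ V ∧ (y = a ∨ y = b) ∧
        dist x y = min (dist x a) (dist x b) ∧
        dist a x + dist x b = dist a b ∧
        0 < dist a x ∧ 0 < dist x b ∧
        dist x w ≤ (ε / (2 + ε)) * dist x y ∧
        R y w ≤ ENNReal.ofReal (dist y x + dist x w)) :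
    ∀ u ∈ V, ∀ v ∈ V, deltaH V R u v ≤ ENNReal.ofReal ((1 + ε) * dist u v) := by
  by_contra! hbad
  obtain ⟨u₀, hu₀, v₀, hv₀, h₀⟩ := hbad
  obtain ⟨⟨u, v⟩, huv, hmin⟩ := Finset.exists_min_image
    ({e ∈ V ×ˢ V | ENNReal.ofReal ((1 + ε) * dist e.1 e.2) < deltaH V R e.1 e.2})
    (fun e => dist e.1 e.2) ⟨(u₀, v₀), by simp [hu₀, hv₀, h₀]⟩
  simp only [Finset.mem_filter, Finset.mem_product, Prod.forall] at huv hmin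
  obtain ⟨⟨hu, hv⟩, hlt⟩ := huv
  have ih : ∀ a ∈ V, ∀ b ∈ V, dist a b < dist u v →
      deltaH V R a b ≤ ENNReal.ofReal ((1 + ε) * dist a b) := fun a ha b hb hab =>
    le_of_not_gt fun h => absurd (hmin a b ⟨⟨ha, hb⟩, h⟩) hab.not_ge
  have hedge : ENNReal.ofReal (dist u v) < R u v := by
    refine lt_of_le_of_lt ?_ (hlt.trans_le (deltaH_le_edge hu hv))
    gcongr
    nlinarith [dist_nonneg (x := u) (y := v)]
  obtain ⟨x, w, y, hw, hy, -, hsum, hux, hxv, hxw, hR⟩ := hkey u hu v hv hedge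
  refine hlt.not_ge ?_
  rcases hy with rfl | rfl
  · rw [dist_comm x y] at hxw
    have hwv : dist w v ≤ dist x w + dist x v := dist_comm x w ▸ dist_triangle w x v
    obtain ⟨hd, hle⟩ := detour_bounds hε hux hxw hwv
    rw [hsum] at hd hle
    calc deltaH V R y v ≤ R y w + deltaH V R w v := deltaH_le_edge_add hu
      _ ≤ ENNReal.ofReal (dist y x + dist x w) + ENNReal.ofReal ((1 + ε) * dist w v) :=
        add_le_add hR (ih w hw v hv hd)
      _ = ENNReal.ofReal (dist y x + dist x w + (1 + ε) * dist w v) :=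
        (ENNReal.ofReal_add (by positivity) (by positivity)).symm
      _ ≤ _ := ENNReal.ofReal_le_ofReal hle
  · have huw : dist u w ≤ dist x w + dist u x := add_comm (dist u x) _ ▸ dist_triangle u x w
    obtain ⟨hd, hle⟩ := detour_bounds hε hxv hxw huw
    rw [add_comm (dist x y) (dist u x), hsum] at hd hle
    rw [hsym y hv w hw, dist_comm y x] at hR
    calc deltaH V R u y ≤ R w y + deltaH V R u w :=
          (deltaH_le_add_edge hv).trans_eq (add_comm _ _)
      _ ≤ ENNReal.ofReal (dist x y + dist x w) + ENNReal.ofReal ((1 + ε) * dist u w) :=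
        add_le_add hR (ih u hu w hw hd)
      _ = ENNReal.ofReal (dist x y + dist x w + (1 + ε) * dist u w) :=
        (ENNReal.ofReal_add (by positivity) (by positivity)).symm
      _ ≤ _ := ENNReal.ofReal_le_ofReal hle
end

section
/- Let n ≥ 2 and x, y ≥ 1 be integers, and let U be a finite set with |U| = n. Then there exists a family 𝒮 of subsets of U with |𝒮| ≤ ⌊((x+y)^{x+y+1}/(x^x·y^y))·ln n⌋ + 1 such that for all subsets X, Y ⊆ U with |X| = x, |Y| = y and X ∩ Y = ∅, there exists S ∈ 𝒮 with X ⊆ S and Y ∩ S = ∅. -/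
open Finset in
/-- Weighted averaging: if every `b ∈ P` is hit by weight at least `r`, some `a` misses at most a
`1 - r` proportion of `P`. -/
theorem exists_card_filter_not_le {α β : Type*} [Fintype α] (R : α → β → Prop)
    [∀ a b, Decidable (R a b)] (w : α → ℝ) (hw : ∀ a, 0 < w a) (hw1 : ∑ a, w a = 1)
    (r : ℝ) (P : Finset β) (hP : ∀ b ∈ P, r ≤ ∑ a with R a b, w a) :
    ∃ a, ((P.filter fun b => ¬ R a b).card : ℝ) ≤ (1 - r) * P.card := by
  have hne : (univ : Finset α).Nonempty := by
    rw [nonempty_iff_ne_empty]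
    intro h
    simp [h] at hw1
  have hsum : ∑ a, w a * ((P.filter fun b => ¬ R a b).card : ℝ)
      ≤ ∑ a, w a * ((1 - r) * P.card) := by
    rw [← sum_mul, hw1, one_mul]
    calc ∑ a, w a * ((P.filter fun b => ¬ R a b).card : ℝ)
        = ∑ a, ∑ b ∈ P, if ¬ R a b then w a else 0 := by
          refine sum_congr rfl fun a _ => ?_
          rw [← sum_filter, sum_const, nsmul_eq_mul, mul_comm]
      _ = ∑ b ∈ P, ∑ a with ¬ R a b, w a := by
          rw [sum_comm]
          exact sum_congr rfl fun b _ => (sum_filter _ _).symm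
      _ ≤ ∑ b ∈ P, (1 - r) := by
          refine sum_le_sum fun b hb => ?_
          have h := sum_filter_add_sum_filter_not univ (fun a => R a b) w
          linarith [hP b hb]
      _ = (1 - r) * P.card := by rw [sum_const, nsmul_eq_mul, mul_comm]
  obtain ⟨a, -, ha⟩ := exists_le_of_sum_le hne hsum
  exact ⟨a, le_of_mul_le_mul_left ha (hw a)⟩

/-- Greedy covering: `t` elements can be chosen so that at most a `(1 - r) ^ t` proportion of `P`
is hit by none of them. -/
theorem exists_card_le_card_filter_le {α β : Type*} [Fintype α] [DecidableEq α] (R : α → β → Prop)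
    [∀ a b, Decidable (R a b)] (w : α → ℝ) (hw : ∀ a, 0 < w a) (hw1 : ∑ a, w a = 1)
    (r : ℝ) (hr : r ≤ 1) (P : Finset β) (hP : ∀ b ∈ P, r ≤ ∑ a with R a b, w a) (t : ℕ) :
    ∃ T : Finset α, T.card ≤ t ∧
      ((P.filter fun b => ∀ a ∈ T, ¬ R a b).card : ℝ) ≤ (1 - r) ^ t * P.card := by
  induction t with
  | zero => exact ⟨∅, by simp⟩
  | succ t ih =>
    obtain ⟨T, hT, hc⟩ := ih
    obtain ⟨a, ha⟩ := exists_card_filter_not_le R w hw hw1 r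
      (P.filter fun b => ∀ a ∈ T, ¬ R a b) fun b hb => hP b (Finset.mem_of_mem_filter b hb)
    refine ⟨insert a T, (Finset.card_insert_le a T).trans (by omega), ?_⟩
    rw [Finset.filter_filter] at ha
    have heq : (P.filter fun b => ∀ c ∈ insert a T, ¬ R c b)
        = P.filter fun b => (∀ c ∈ T, ¬ R c b) ∧ ¬ R a b := by
      refine Finset.filter_congr fun b _ => ?_
      rw [Finset.forall_mem_insert, and_comm]
    rw [heq, pow_succ']
    calc _ ≤ _ := ha
      _ ≤ (1 - r) * ((1 - r) ^ t * P.card) :=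
        mul_le_mul_of_nonneg_left hc (sub_nonneg.2 hr)
      _ = _ := by ring

open Finset in
/-- The probability that a `p`-random subset contains `X` and avoids `Y`. -/
theorem sum_pow_card_filter_subset_disjoint {U : Type*} [Fintype U] [DecidableEq U] (p q : ℝ)
    (hpq : p + q = 1) (X Y : Finset U) (hXY : Disjoint X Y) :
    ∑ S : Finset U with X ⊆ S ∧ Y ∩ S = ∅, p ^ S.card * q ^ Sᶜ.card
      = p ^ X.card * q ^ Y.card := by
  have key := prod_add (fun i => if i ∈ Y then 0 else p) (fun i => if i ∈ X then 0 else q)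
    (univ : Finset U)
  have hL : ∏ i : U, ((if i ∈ Y then 0 else p) + (if i ∈ X then 0 else q))
      = p ^ X.card * q ^ Y.card := by
    calc _ = ∏ i : U, ((if i ∈ X then p else 1) * (if i ∈ Y then q else 1)) := by
          refine prod_congr rfl fun i _ => ?_
          by_cases h1 : i ∈ X
          · simp [h1, disjoint_left.1 hXY h1]
          · by_cases h2 : i ∈ Y <;> simp [h1, h2, hpq]
      _ = _ := by
          rw [prod_mul_distrib, prod_ite_mem, prod_ite_mem]
          simp
  rw [← hL, key, powerset_univ, sum_filter]
  refine sum_congr rfl fun S _ => ?_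
  rw [← compl_eq_univ_sdiff]
  split_ifs with h
  · congr 1
    · rw [← prod_const]
      refine prod_congr rfl fun i hi => (if_neg fun hY => ?_).symm
      exact notMem_empty i (h.2 ▸ mem_inter.2 ⟨hY, hi⟩)
    · rw [← prod_const]
      refine prod_congr rfl fun i hi => (if_neg fun hX => ?_).symm
      exact mem_compl.1 hi (h.1 hX)
  · symm
    by_cases h1 : X ⊆ S
    · obtain ⟨i, hi⟩ := nonempty_iff_ne_empty.2 fun h2 => h ⟨h1, h2⟩
      rw [mem_inter] at hi
      refine mul_eq_zero_of_left (prod_eq_zero hi.2 ?_) _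
      exact if_pos hi.1
    · obtain ⟨i, hi, hiS⟩ := not_subset.1 h1
      refine mul_eq_zero_of_right _ (prod_eq_zero (mem_compl.2 hiS) ?_)
      exact if_pos hi


/-- Existence of `(x,y)`-families. Let `U` be a finite set with `|U| = n ≥ 2` and
`x, y ≥ 1` integers. Then there is a family `𝒮` of subsets of `U` with
`|𝒮| ≤ ⌊((x+y)^(x+y+1) / (x^x * y^y)) * ln n⌋ + 1` such that for all disjoint
`X, Y ⊆ U` with `|X| = x` and `|Y| = y`, there is `S ∈ 𝒮` with `X ⊆ S` and
`Y ∩ S = ∅`. -/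
theorem stmt10 {U : Type*} [Fintype U] [DecidableEq U] (n x y : ℕ)
    (hn : 2 ≤ n) (hx : 1 ≤ x) (hy : 1 ≤ y) (hU : Fintype.card U = n) :
    ∃ 𝒮 : Finset (Finset U),
      ((𝒮.card : ℤ) ≤
        ⌊(((x : ℝ) + y) ^ (x + y + 1) / ((x : ℝ) ^ x * (y : ℝ) ^ y)) *
          Real.log n⌋ + 1) ∧
      ∀ X Y : Finset U, X.card = x → Y.card = y → Disjoint X Y →
        ∃ S ∈ 𝒮, X ⊆ S ∧ Y ∩ S = ∅ := by
  have hxpos : (0 : ℝ) < x := by exact_mod_cast hx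
  have hypos : (0 : ℝ) < y := by exact_mod_cast hy
  have hnpos : (0 : ℝ) < n := by exact_mod_cast (by omega : 0 < n)
  have hspos : (0 : ℝ) < x + y := by positivity
  set p : ℝ := x / (x + y) with hp
  set q : ℝ := y / (x + y) with hq
  have hp0 : 0 < p := by positivity
  have hq0 : 0 < q := by positivity
  have hpq : p + q = 1 := by rw [hp, hq]; field_simp
  set r : ℝ := p ^ x * q ^ y with hr
  have hr0 : 0 < r := by positivity
  have hr1 : r ≤ 1 :=
    mul_le_one₀ (pow_le_one₀ hp0.le (by linarith)) (by positivity)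
      (pow_le_one₀ hq0.le (by linarith))
  set A : ℝ := ((x : ℝ) + y) ^ (x + y + 1) / ((x : ℝ) ^ x * (y : ℝ) ^ y) * Real.log n with hA
  have hlog : 0 ≤ Real.log n := Real.log_natCast_nonneg n
  have hA0 : 0 ≤ A := by positivity
  have hrA : r * A = (x + y) * Real.log n := by
    rw [hr, hA, hp, hq, div_pow, div_pow, pow_succ, pow_add]
    field_simp
  let P : Finset (Finset U × Finset U) :=
    (Finset.powersetCard x Finset.univ ×ˢ Finset.powersetCard y Finset.univ).filter
      fun b => Disjoint b.1 b.2
  have hPcard : (P.card : ℝ) ≤ (n : ℝ) ^ (x + y) := by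
    have h : P.card ≤ n ^ (x + y) := by
      refine (Finset.card_filter_le _ _).trans ?_
      rw [Finset.card_product, Finset.card_powersetCard, Finset.card_powersetCard,
        Finset.card_univ, hU, pow_add]
      exact Nat.mul_le_mul (Nat.choose_le_pow n x) (Nat.choose_le_pow n y)
    exact_mod_cast h
  obtain ⟨T, hT, hTP⟩ := exists_card_le_card_filter_le
    (fun (S : Finset U) (b : Finset U × Finset U) => b.1 ⊆ S ∧ b.2 ∩ S = ∅)
    (fun S => p ^ S.card * q ^ Sᶜ.card) (fun S => by positivity)
    (by simpa using sum_pow_card_filter_subset_disjoint (U := U) p q hpq ∅ ∅ (by simp))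
    r hr1 P (fun b hb => by
      simp only [P, Finset.mem_filter, Finset.mem_product, Finset.mem_powersetCard] at hb
      rw [sum_pow_card_filter_subset_disjoint p q hpq b.1 b.2 hb.2, hb.1.1.2, hb.1.2.2])
    (⌊A⌋₊ + 1)
  refine ⟨T, ?_, fun X Y hX hY hXY => ?_⟩
  · rw [← Int.natCast_floor_eq_floor hA0]
    exact_mod_cast hT
  have hlt : (1 - r) ^ (⌊A⌋₊ + 1) * (P.card : ℝ) < 1 := by
    have hexp : (1 - r) ^ (⌊A⌋₊ + 1) < ((n : ℝ) ^ (x + y))⁻¹ := by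
      calc (1 - r) ^ (⌊A⌋₊ + 1) ≤ Real.exp (-r) ^ (⌊A⌋₊ + 1) :=
            pow_le_pow_left₀ (sub_nonneg.2 hr1) (Real.one_sub_le_exp_neg r) _
        _ = Real.exp (-(r * (⌊A⌋₊ + 1))) := by
            rw [← Real.exp_nat_mul]; push_cast; ring_nf
        _ < Real.exp (-(r * A)) := by
            have := mul_lt_mul_of_pos_left (Nat.lt_floor_add_one A) hr0
            exact Real.exp_lt_exp.2 (neg_lt_neg this)
        _ = ((n : ℝ) ^ (x + y))⁻¹ := by
            rw [hrA, Real.exp_neg, ← Nat.cast_add, Real.exp_nat_mul, Real.exp_log hnpos]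
    have hnp : (0 : ℝ) < (n : ℝ) ^ (x + y) := by positivity
    calc (1 - r) ^ (⌊A⌋₊ + 1) * (P.card : ℝ)
        ≤ (1 - r) ^ (⌊A⌋₊ + 1) * (n : ℝ) ^ (x + y) :=
          mul_le_mul_of_nonneg_left hPcard (pow_nonneg (sub_nonneg.2 hr1) _)
      _ < ((n : ℝ) ^ (x + y))⁻¹ * (n : ℝ) ^ (x + y) := mul_lt_mul_of_pos_right hexp hnp
      _ = 1 := inv_mul_cancel₀ hnp.ne'
  have hempty := Finset.card_eq_zero.1 (Nat.lt_one_iff.1 (by exact_mod_cast hTP.trans_lt hlt))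
  have hmem : (X, Y) ∈ P := by
    simp [P, Finset.mem_powersetCard, hX, hY, hXY]
  by_contra! hcon
  refine Finset.filter_eq_empty_iff.1 hempty hmem fun S hS h => ?_
  exact (hcon S hS h.1).ne_empty h.2
end

section
/- Let V be a finite type, r : V → V → Prop a directed graph on V, V′ ⊆ V, and x, y natural numbers. For W ⊆ V and u, v ∈ V, say that u reaches v within W if there is a finite sequence u = v_0, v_1, …, v_m = v with v_i ∈ W for all 0 ≤ i ≤ m and r(v_i, v_{i+1}) for all i < m. Let 𝒮 be a family of subsets of V′ such that for all X ⊆ V′ with |X| ≤ x and all Y ⊆ V′ with |Y| ≤ y and X ∩ Y = ∅, there exists S ∈ 𝒮 with X ⊆ S and Y ∩ S = ∅. Fix u, v ∈ V and assume that every sequence u = v_0, …, v_m = v with r(v_i, v_{i+1}) for all i < m visits at most x distinct vertices of V′. Then for every D ⊆ V′ with |D| ≤ y: u reaches v within V ∖ D if and only if there exists S ∈ 𝒮 with S ∩ D = ∅ such that u reaches v within S ∪ (V ∖ V′). -/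
/-- `ReachWithin r W u v`: there is a finite sequence `u = w 0, …, w m = v` all of
whose vertices lie in `W`, with `r (w i) (w (i+1))` for all `i < m`. -/
def ReachWithin {V : Type*} (r : V → V → Prop) (W : Set V) (u v : V) : Prop :=
  ∃ (m : ℕ) (w : Fin (m + 1) → V), w 0 = u ∧ w (Fin.last m) = v ∧
    (∀ i, w i ∈ W) ∧ ∀ i : Fin m, r (w i.castSucc) (w i.succ)

/-- Correctness of the `(x,y)`-family data structure (Lemma 5.5). Let `V` be a finite
type, `r` a directed graph on `V`, `V' ⊆ V`, and `𝒮` a family of subsets of `V'` such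
that for all disjoint `X, Y ⊆ V'` with `|X| ≤ x`, `|Y| ≤ y` there is `S ∈ 𝒮` with
`X ⊆ S` and `Y ∩ S = ∅`. Fix `u, v` and assume every `r`-path from `u` to `v` visits
at most `x` distinct vertices of `V'`. Then for every `D ⊆ V'` with `|D| ≤ y`:
`u` reaches `v` within `V \ D` iff there is `S ∈ 𝒮` with `S ∩ D = ∅` such that `u`
reaches `v` within `S ∪ (V \ V')`. -/
theorem stmt11 {V : Type*} [Fintype V] (r : V → V → Prop) (V' : Set V) (x y : ℕ)
    (𝒮 : Set (Set V)) (h𝒮 : ∀ S ∈ 𝒮, S ⊆ V')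
    (hfam : ∀ X Y : Set V, X ⊆ V' → Y ⊆ V' → X.ncard ≤ x → Y.ncard ≤ y →
      X ∩ Y = ∅ → ∃ S ∈ 𝒮, X ⊆ S ∧ Y ∩ S = ∅)
    (u v : V)
    (hpath : ∀ (m : ℕ) (w : Fin (m + 1) → V), w 0 = u → w (Fin.last m) = v →
      (∀ i : Fin m, r (w i.castSucc) (w i.succ)) →
      (Set.range w ∩ V').ncard ≤ x) :
    ∀ D ⊆ V', D.ncard ≤ y →
      (ReachWithin r (Set.univ \ D) u v ↔
        ∃ S ∈ 𝒮, S ∩ D = ∅ ∧ ReachWithin r (S ∪ (Set.univ \ V')) u v) := by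
  intro D hD hDy
  constructor
  · rintro ⟨m, w, h0, hm, hW, hr⟩
    obtain ⟨S, hS, hXS, hDS⟩ := hfam (Set.range w ∩ V') D Set.inter_subset_right hD
      (hpath m w h0 hm hr) hDy (by
        ext z
        simp only [Set.mem_inter_iff, Set.mem_empty_iff_false, iff_false]
        rintro ⟨⟨⟨i, rfl⟩, -⟩, hz⟩
        exact (hW i).2 hz)
    refine ⟨S, hS, by rwa [Set.inter_comm], m, w, h0, hm, fun i => ?_, hr⟩
    by_cases hi : w i ∈ V'
    · exact Or.inl (hXS ⟨⟨i, rfl⟩, hi⟩)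
    · exact Or.inr ⟨trivial, hi⟩
  · rintro ⟨S, -, hSD, m, w, h0, hm, hW, hr⟩
    refine ⟨m, w, h0, hm, fun i => ⟨trivial, fun hi => ?_⟩, hr⟩
    rcases hW i with h | h
    · exact (Set.eq_empty_iff_forall_notMem.mp hSD) (w i) ⟨h, hi⟩
    · exact h.2 (hD hi)
end
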